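/- Writing I_{2k+1} = ∫_ℝ (X_{2k+1}(x))² dx with X_{2k+1}(x) = ∫_{−∞}^x h_{2k+1}(t) dt, the recursion I_{2k+1} = 2/(2k+1) + (2k/(2k+1)) · I_{2k−1} holds for every k ≥ 1. -/

import Mathlib

open MeasureTheory Real

/-- The normalized Hermite function of degree `k`:
`h_k(t) = (−1)^k (2^k k! √π)^{−1/2} e^{t²/2} (d/dt)^k(e^{−t²})`. -/
noncomputable def hermiteFun (k : ℕ) (t : ℝ) : ℝ :=
  (-1 : ℝ) ^ k * ((2 : ℝ) ^ k * (Nat.factorial k : ℝ) * Real.sqrt π) ^ (-(1 : ℝ) / 2) *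
    Real.exp (t ^ 2 / 2) * iteratedDeriv k (fun s : ℝ => Real.exp (-s ^ 2)) t

/-- The antiderivative `X_{2k+1}(x) = ∫_{−∞}^x h_{2k+1}(t) dt`. -/
noncomputable def Xodd (k : ℕ) (x : ℝ) : ℝ :=
  ∫ t in Set.Iic x, hermiteFun (2 * k + 1) t

/-- `I_{2k+1} = ∫_ℝ (X_{2k+1}(x))² dx`. -/
noncomputable def Iodd (k : ℕ) : ℝ :=
  ∫ x : ℝ, (Xodd k x) ^ 2

open Polynomial in
/-- The physicists' Hermite polynomials. -/
noncomputable def physHermite : ℕ → ℝ[X]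
  | 0 => 1
  | n + 1 => 2 * X * physHermite n - derivative (physHermite n)

open Polynomial in
/-- The polynomial factor of the decaying antiderivative of `physHermite (2 * k + 1)` times
`exp (-x ^ 2 / 2)`. -/
noncomputable def oddPrimitive : ℕ → ℝ[X]
  | 0 => -2
  | k + 1 => C (4 * ((k : ℝ) + 1)) * oddPrimitive k - 2 * physHermite (2 * k + 2)

section Hermite

open Polynomial

theorem derivative_physHermite (n : ℕ) :
    derivative (physHermite (n + 1)) = C (2 * ((n : ℝ) + 1)) * physHermite n := by
  induction n with
  | zero => simp [physHermite, map_ofNat C 2]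
  | succ n ih =>
    have h : physHermite (n + 1) = 2 * X * physHermite n - derivative (physHermite n) := rfl
    rw [physHermite, derivative_sub, derivative_mul, ih, derivative_C_mul, h]
    simp [map_ofNat C 2]
    ring

theorem natDegree_physHermite_le (n : ℕ) : (physHermite n).natDegree ≤ n := by
  induction n with
  | zero => simp [physHermite]
  | succ n ih =>
    rw [physHermite]
    refine (natDegree_sub_le _ _).trans (max_le ?_ ?_)
    · refine natDegree_mul_le.trans ?_
      have h : (2 * X : ℝ[X]).natDegree ≤ 1 := natDegree_C_mul_le 2 X |>.trans natDegree_X_le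
      omega
    · have := natDegree_derivative_le (physHermite n)
      omega

theorem natDegree_oddPrimitive_le (k : ℕ) : (oddPrimitive k).natDegree ≤ 2 * k := by
  induction k with
  | zero => simp [oddPrimitive]
  | succ k ih =>
    rw [oddPrimitive]
    refine (natDegree_sub_le _ _).trans (max_le ?_ ?_)
    · exact (natDegree_C_mul_le _ _).trans (by omega)
    · exact (natDegree_C_mul_le 2 _).trans (natDegree_physHermite_le _)

theorem hasDerivAt_eval_mul_exp_neg_mul_sq (P : ℝ[X]) (b x : ℝ) :
    HasDerivAt (fun x => P.eval x * Real.exp (-b * x ^ 2))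
      ((derivative P - C (2 * b) * X * P).eval x * Real.exp (-b * x ^ 2)) x := by
  have h : HasDerivAt (fun x : ℝ => -b * x ^ 2) (-b * (2 * x)) x := by
    simpa using (hasDerivAt_pow 2 x).const_mul (-b)
  convert! (P.hasDerivAt x).mul h.exp using 1
  simp
  ring

theorem integrable_eval_mul_exp_neg_mul_sq (P : ℝ[X]) {b : ℝ} (hb : 0 < b) :
    Integrable fun x : ℝ => P.eval x * Real.exp (-b * x ^ 2) := by
  induction P using Polynomial.induction_on' with
  | add p q hp hq =>
    simp only [eval_add, add_mul]
    exact hp.add hq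
  | monomial n a =>
    have h := integrable_rpow_mul_exp_neg_mul_sq hb (s := n)
      (lt_of_lt_of_le (by norm_num) n.cast_nonneg)
    simpa [mul_assoc] using h.const_mul a

theorem iteratedDeriv_exp_neg_sq (n : ℕ) :
    iteratedDeriv n (fun s : ℝ => Real.exp (-s ^ 2)) =
      fun t => (-1) ^ n * (physHermite n).eval t * Real.exp (-t ^ 2) := by
  induction n with
  | zero => simp [physHermite]
  | succ n ih =>
    rw [iteratedDeriv_succ, ih]
    ext t
    have h := (hasDerivAt_eval_mul_exp_neg_mul_sq (physHermite n) 1 t).const_mul ((-1) ^ n)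
    simp only [neg_mul, one_mul, ← mul_assoc] at h
    rw [h.deriv, physHermite]
    simp
    ring

theorem hermiteFun_eq (n : ℕ) (t : ℝ) :
    hermiteFun n t = ((2 : ℝ) ^ n * (n.factorial : ℝ) * √π) ^ (-(1 : ℝ) / 2) *
      ((physHermite n).eval t * Real.exp (-(1 / 2) * t ^ 2)) := by
  have hs : ((-1 : ℝ) ^ n) * (-1) ^ n = 1 := by rw [← mul_pow]; simp
  have he : Real.exp (t ^ 2 / 2) * Real.exp (-t ^ 2) = Real.exp (-(1 / 2) * t ^ 2) := by
    rw [← Real.exp_add]; ring_nf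
  rw [hermiteFun, iteratedDeriv_exp_neg_sq, ← he]
  linear_combination (((2 : ℝ) ^ n * (n.factorial : ℝ) * √π) ^ (-(1 : ℝ) / 2) *
    (physHermite n).eval t * Real.exp (t ^ 2 / 2) * Real.exp (-t ^ 2)) * hs

/-- The Gaussian integral `∫ P(x) e^{-x²} dx`. -/
noncomputable def gaussInt (P : ℝ[X]) : ℝ := ∫ x : ℝ, P.eval x * Real.exp (-1 * x ^ 2)

theorem gaussInt_add (P Q : ℝ[X]) : gaussInt (P + Q) = gaussInt P + gaussInt Q := by
  simp only [gaussInt, eval_add, add_mul]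
  exact integral_add (integrable_eval_mul_exp_neg_mul_sq P one_pos)
    (integrable_eval_mul_exp_neg_mul_sq Q one_pos)

theorem gaussInt_C_mul (a : ℝ) (P : ℝ[X]) : gaussInt (C a * P) = a * gaussInt P := by
  simp only [gaussInt, eval_mul, eval_C, mul_assoc]
  exact integral_const_mul _ _

theorem gaussInt_mul_physHermite_succ (P : ℝ[X]) (n : ℕ) :
    gaussInt (P * physHermite (n + 1)) = gaussInt (derivative P * physHermite n) := by
  have h0 : gaussInt (derivative (P * physHermite n) - C (2 * 1) * X * (P * physHermite n)) = 0 :=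
    integral_eq_zero_of_hasDerivAt_of_integrable
      (hasDerivAt_eval_mul_exp_neg_mul_sq (P * physHermite n) 1)
      (integrable_eval_mul_exp_neg_mul_sq _ one_pos)
      (integrable_eval_mul_exp_neg_mul_sq _ one_pos)
  have h : derivative P * physHermite n = P * physHermite (n + 1) +
      (derivative (P * physHermite n) - C (2 * 1) * X * (P * physHermite n)) := by
    rw [physHermite, derivative_mul]
    simp [map_ofNat C 2]
    ring
  rw [h, gaussInt_add, h0, add_zero]

theorem gaussInt_mul_physHermite_of_natDegree_lt (P : ℝ[X]) (n : ℕ) (h : P.natDegree < n) :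
    gaussInt (P * physHermite n) = 0 := by
  induction n generalizing P with
  | zero => omega
  | succ n ih =>
    rw [gaussInt_mul_physHermite_succ]
    by_cases hP : P.natDegree = 0
    · rw [derivative_of_natDegree_zero hP]
      simp [gaussInt]
    · exact ih _ ((natDegree_derivative_lt hP).trans_le (by omega))

theorem gaussInt_physHermite_sq (n : ℕ) :
    gaussInt (physHermite n * physHermite n) = 2 ^ n * (n.factorial : ℝ) * √π := by
  induction n with
  | zero =>
    have := integral_gaussian 1
    simpa [gaussInt, physHermite] using this
  | succ n ih =>
    rw [gaussInt_mul_physHermite_succ, derivative_physHermite, mul_assoc, gaussInt_C_mul, ih,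
      Nat.factorial_succ]
    push_cast
    ring

theorem gaussInt_oddPrimitive_sq_succ (k : ℕ) :
    gaussInt (oddPrimitive (k + 1) * oddPrimitive (k + 1)) =
      16 * ((k : ℝ) + 1) ^ 2 * gaussInt (oddPrimitive k * oddPrimitive k) +
        4 * (2 ^ (2 * k + 2) * ((2 * k + 2).factorial : ℝ) * √π) := by
  have h : oddPrimitive (k + 1) * oddPrimitive (k + 1) =
      C (16 * ((k : ℝ) + 1) ^ 2) * (oddPrimitive k * oddPrimitive k) +
        (C (-16 * ((k : ℝ) + 1)) * (oddPrimitive k * physHermite (2 * k + 2)) +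
          C 4 * (physHermite (2 * k + 2) * physHermite (2 * k + 2))) := by
    rw [oddPrimitive]
    simp only [map_mul, map_add, map_pow, map_neg, map_ofNat, map_one]
    ring
  rw [h, gaussInt_add, gaussInt_add, gaussInt_C_mul, gaussInt_C_mul, gaussInt_C_mul,
    gaussInt_physHermite_sq, gaussInt_mul_physHermite_of_natDegree_lt _ _
      ((natDegree_oddPrimitive_le k).trans_lt (by omega))]
  ring

theorem derivative_oddPrimitive_sub (k : ℕ) :
    derivative (oddPrimitive k) - X * oddPrimitive k = physHermite (2 * k + 1) := by
  induction k with
  | zero =>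
    simp [oddPrimitive, physHermite]
    ring
  | succ k ih =>
    have h3 : physHermite (2 * (k + 1) + 1) = 2 * X * physHermite (2 * k + 2) -
        derivative (physHermite (2 * k + 2)) := rfl
    have hd := derivative_physHermite (2 * k + 1)
    have h2 : derivative (2 * physHermite (2 * k + 2)) =
      2 * derivative (physHermite (2 * k + 2)) := derivative_C_mul 2 _
    rw [oddPrimitive, derivative_sub, derivative_C_mul, h2, h3, hd, ← ih]
    simp [map_ofNat C 2, map_ofNat C 4]
    ring

theorem integral_Iic_eval_mul_exp (P : ℝ[X]) {b : ℝ} (hb : 0 < b) (x : ℝ) :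
    ∫ t in Set.Iic x, (derivative P - C (2 * b) * X * P).eval t * Real.exp (-b * t ^ 2) =
      P.eval x * Real.exp (-b * x ^ 2) := by
  have hd := hasDerivAt_eval_mul_exp_neg_mul_sq P b
  have hi := integrable_eval_mul_exp_neg_mul_sq P hb
  have hi' := integrable_eval_mul_exp_neg_mul_sq (derivative P - C (2 * b) * X * P) hb
  have ht := tendsto_zero_of_hasDerivAt_of_integrableOn_Iic (a := x) (fun t _ => hd t)
    hi'.integrableOn hi.integrableOn
  simpa using integral_Iic_of_hasDerivAt_of_tendsto' (fun t _ => hd t) hi'.integrableOn ht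

theorem Xodd_eq (k : ℕ) (x : ℝ) :
    Xodd k x = ((2 : ℝ) ^ (2 * k + 1) * ((2 * k + 1).factorial : ℝ) * √π) ^ (-(1 : ℝ) / 2) *
      ((oddPrimitive k).eval x * Real.exp (-(1 / 2) * x ^ 2)) := by
  have h : derivative (oddPrimitive k) - C (2 * (1 / 2)) * X * oddPrimitive k =
      physHermite (2 * k + 1) := by
    rw [← derivative_oddPrimitive_sub]
    norm_num
  simp only [Xodd, hermiteFun_eq]
  rw [integral_const_mul, ← h, integral_Iic_eval_mul_exp _ (by norm_num)]

theorem Iodd_eq (k : ℕ) :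
    Iodd k = gaussInt (oddPrimitive k * oddPrimitive k) /
      ((2 : ℝ) ^ (2 * k + 1) * ((2 * k + 1).factorial : ℝ) * √π) := by
  have hpos : 0 < (2 : ℝ) ^ (2 * k + 1) * ((2 * k + 1).factorial : ℝ) * √π := by positivity
  rw [Iodd, gaussInt, div_eq_inv_mul, ← integral_const_mul]
  congr 1 with x
  have hc : (((2 : ℝ) ^ (2 * k + 1) * ((2 * k + 1).factorial : ℝ) * √π) ^ (-(1 : ℝ) / 2)) ^ 2 =
      ((2 : ℝ) ^ (2 * k + 1) * ((2 * k + 1).factorial : ℝ) * √π)⁻¹ := by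
    rw [← Real.rpow_mul_natCast hpos.le, ← Real.rpow_neg_one]
    norm_num
  have he : Real.exp (-(1 / 2) * x ^ 2) ^ 2 = Real.exp (-1 * x ^ 2) := by
    rw [← Real.exp_nat_mul]
    congr 1
    push_cast
    ring
  rw [Xodd_eq, mul_pow, mul_pow, hc, he, eval_mul, sq]

end Hermite

theorem odd_L2_recursion (k : ℕ) (hk : 1 ≤ k) :
    Iodd k = 2 / (2 * (k : ℝ) + 1) + (2 * (k : ℝ) / (2 * (k : ℝ) + 1)) * Iodd (k - 1) := by
  obtain ⟨k, rfl⟩ := Nat.exists_eq_add_of_le' hk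
  have hf : ((2 * (k + 1) + 1).factorial : ℝ) =
      (2 * k + 3) * ((2 * k + 2) * ((2 * k + 1).factorial : ℝ)) := by
    rw [show 2 * (k + 1) + 1 = 2 * k + 1 + 1 + 1 by ring, Nat.factorial_succ, Nat.factorial_succ]
    push_cast
    ring
  have hf' : ((2 * k + 2).factorial : ℝ) = (2 * k + 2) * ((2 * k + 1).factorial : ℝ) := by
    rw [Nat.factorial_succ]
    push_cast
    ring
  have hpi : √π ≠ 0 := by positivity
  have hfac : ((2 * k + 1).factorial : ℝ) ≠ 0 := by positivity
  have h3 : 2 * ((k : ℝ) + 1) + 1 ≠ 0 := by positivity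
  have h3' : 2 * (k : ℝ) + 3 ≠ 0 := by positivity
  have h2 : 2 * (k : ℝ) + 2 ≠ 0 := by positivity
  rw [Nat.add_sub_cancel, Iodd_eq, Iodd_eq, gaussInt_oddPrimitive_sq_succ, hf, hf',
    show 2 * (k + 1) + 1 = 2 * k + 1 + 2 by ring, show 2 * k + 2 = 2 * k + 1 + 1 by ring,
    pow_add _ _ 2, pow_succ _ (2 * k + 1)]
  push_cast
  field_simp
  ring
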